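/- arXiv:1002.4500 — 3 statements merged into one kernel-verified Lean document; each statement's English description precedes it below -/
import Mathlib

section
/- For coprime integers p, q ≥ 2, the discrete sum ∑_{k=1}^{p−1} ∑_{l=1}^{q−1} (1 − 2|k/p + l/q − 1|) equals (1/3)(p − 1/p)(q − 1/q). -/
open scoped Classical

/-- The set Σ(p,q) = {k/p + l/q : 1 ≤ k ≤ p−1, 1 ≤ l ≤ q−1} ⊆ ℝ. -/
noncomputable def sigmaSet (p q : ℕ) : Finset ℝ :=
  ((Finset.Icc 1 (p - 1)) ×ˢ (Finset.Icc 1 (q - 1))).image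
    (fun kl => (kl.1 : ℝ) / p + (kl.2 : ℝ) / q)

/-- Litherland's formula: σ̂(x) = |Σ(p,q) \ (x,x+1)| − |Σ(p,q) ∩ (x,x+1)|. -/
noncomputable def sigHat (p q : ℕ) (x : ℝ) : ℤ :=
  (((sigmaSet p q).filter (fun y => y ∉ Set.Ioo x (x + 1))).card : ℤ)
    - (((sigmaSet p q).filter (fun y => y ∈ Set.Ioo x (x + 1))).card : ℤ)

/-- The sawtooth function ((x)). -/
noncomputable def saw (x : ℝ) : ℝ :=
  if ∃ n : ℤ, x = n then 0 else Int.fract x - 1 / 2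

/-- The Dedekind sum s(a,b). -/
noncomputable def dedekindSum (a b : ℕ) : ℝ :=
  ∑ j ∈ Finset.range b, saw ((j : ℝ) / b) * saw ((a : ℝ) * j / b)

/-- The generalized Dedekind sum s(a,b;x,y). -/
noncomputable def dedekindSumGen (a b : ℕ) (x y : ℝ) : ℝ :=
  ∑ j ∈ Finset.range b, saw (((j : ℝ) + y) / b) * saw ((a : ℝ) * ((j : ℝ) + y) / b + x)

/-- N(p,q;C) = #{(k,l) ∈ ℤ²_{≥0} : k/p + l/q < 1 − C}. -/
noncomputable def Ncount (p q : ℕ) (C : ℝ) : ℕ :=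
  Set.ncard {kl : ℕ × ℕ | (kl.1 : ℝ) / p + (kl.2 : ℝ) / q < 1 - C}

/-- The second Bernoulli polynomial evaluated at the fractional part: Ψ₂(x). -/
noncomputable def psi2 (x : ℝ) : ℝ := Int.fract x ^ 2 - Int.fract x + 1 / 6

lemma dsf_sum1 (n : ℕ) : ∑ j ∈ Finset.range n, (j : ℝ) = n * (n - 1) / 2 := by
  induction n with
  | zero => simp
  | succ k ih => rw [Finset.sum_range_succ, ih]; push_cast; ring

lemma dsf_sum2 (n : ℕ) :
    ∑ j ∈ Finset.range n, (j : ℝ) ^ 2 = n * (n - 1) * (2 * n - 1) / 6 := by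
  induction n with
  | zero => simp
  | succ k ih => rw [Finset.sum_range_succ, ih]; push_cast; ring

lemma dsf_crt (p q : ℕ) (hp : 2 ≤ p) (hq : 2 ≤ q) (hpq : Nat.Coprime p q) (g : ℕ → ℝ) :
    ∑ k ∈ Finset.range p, ∑ l ∈ Finset.range q, g ((k * q + l * p) % (p * q)) =
      ∑ j ∈ Finset.range (p * q), g j := by
  have hn : 0 < p * q := by positivity
  have hinj : Set.InjOn (fun kl : ℕ × ℕ => (kl.1 * q + kl.2 * p) % (p * q))
      (Finset.range p ×ˢ Finset.range q : Finset (ℕ × ℕ)) := by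
    rintro ⟨k, l⟩ h ⟨k', l'⟩ h' he
    simp only [Finset.coe_product, Set.mem_prod, Finset.mem_coe, Finset.mem_range] at h h'
    have he : (k * q + l * p) ≡ (k' * q + l' * p) [MOD (p * q)] := he
    have h1 : k * q ≡ k' * q [MOD p] := by
      have := he.of_mul_right q
      simpa [Nat.ModEq] using this
    have h2 : l * p ≡ l' * p [MOD q] := by
      have := he.of_mul_left p
      simpa [Nat.ModEq] using this
    have h3 := Nat.ModEq.cancel_right_of_coprime hpq h1
    have h4 := Nat.ModEq.cancel_right_of_coprime hpq.symm h2
    rw [Nat.ModEq, Nat.mod_eq_of_lt h.1, Nat.mod_eq_of_lt h'.1] at h3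
    rw [Nat.ModEq, Nat.mod_eq_of_lt h.2, Nat.mod_eq_of_lt h'.2] at h4
    rw [h3, h4]
  have him : (Finset.range p ×ˢ Finset.range q).image
      (fun kl : ℕ × ℕ => (kl.1 * q + kl.2 * p) % (p * q)) = Finset.range (p * q) := by
    apply Finset.eq_of_subset_of_card_le
    · intro j hj
      obtain ⟨kl, _, rfl⟩ := Finset.mem_image.1 hj
      exact Finset.mem_range.2 (Nat.mod_lt _ hn)
    · rw [Finset.card_image_of_injOn hinj]; simp
  rw [← him, Finset.sum_image hinj, Finset.sum_product]

lemma dsf_point (p q k l : ℕ) (hk : k < p) (hl : l < q) :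
    |(k : ℝ)/p + (l : ℝ)/q - 1| = ((k : ℝ)/p + (l : ℝ)/q - 1) ^ 2 +
      (fun j : ℕ => ((j : ℝ) / (p * q)) * (1 - (j : ℝ) / (p * q))) ((k * q + l * p) % (p * q)) := by
  have hp : (0 : ℝ) < p := by exact_mod_cast (by omega : 0 < p)
  have hq : (0 : ℝ) < q := by exact_mod_cast (by omega : 0 < q)
  have hx : (k : ℝ)/p + (l : ℝ)/q = ((k * q + l * p : ℕ) : ℝ) / (p * q) := by
    push_cast; field_simp
  have hlt : k * q + l * p < 2 * (p * q) := by nlinarith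
  rw [hx]
  generalize k * q + l * p = m at *
  have hn : (0 : ℝ) < p * q := by positivity
  rcases lt_or_ge m (p * q) with h | h
  · have h' : (m : ℝ) / (p * q) < 1 := by
      rw [div_lt_one hn]; exact_mod_cast h
    rw [Nat.mod_eq_of_lt h, abs_of_neg (by linarith)]
    ring
  · have h' : 1 ≤ (m : ℝ) / (p * q) := by
      rw [one_le_div hn]; exact_mod_cast h
    rw [Nat.mod_eq_sub_mod h, Nat.mod_eq_of_lt (by omega), abs_of_nonneg (by linarith)]
    simp only
    rw [Nat.cast_sub h]; push_cast
    rw [sub_div, div_self hn.ne']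
    ring

lemma dsf_split (p : ℕ) (hp : 2 ≤ p) (f : ℕ → ℝ) :
    ∑ k ∈ Finset.Icc 1 (p - 1), f k = ∑ k ∈ Finset.range p, f k - f 0 := by
  obtain ⟨a, rfl⟩ : ∃ a, p = a + 1 := ⟨p - 1, by omega⟩
  rw [Finset.range_eq_Ico, Finset.sum_eq_sum_Ico_succ_bot (by omega)]
  have : Finset.Icc 1 (a + 1 - 1) = Finset.Ico (0 + 1) (a + 1) := by
    ext; simp only [Finset.mem_Icc, Finset.mem_Ico]; omega
  rw [this]; ring

lemma dsf_row (q : ℕ) (hq : 2 ≤ q) :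
    ∑ l ∈ Finset.range q, (1 - 2 * |(l : ℝ)/q - 1|) = -1 := by
  have hq' : (0 : ℝ) < q := by exact_mod_cast (by omega : 0 < q)
  have : ∀ l ∈ Finset.range q, (1 - 2 * |(l : ℝ)/q - 1|) = (2 / q) * (l : ℝ) - 1 := by
    intro l hl
    have : (l : ℝ) / q < 1 := by
      rw [div_lt_one hq']; exact_mod_cast Finset.mem_range.1 hl
    rw [abs_of_neg (by linarith)]; ring
  rw [Finset.sum_congr rfl this, Finset.sum_sub_distrib, ← Finset.mul_sum, dsf_sum1]
  simp
  field_simp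
  ring

lemma dsf_sq (p q : ℕ) (hp : 2 ≤ p) (hq : 2 ≤ q) :
    ∑ k ∈ Finset.range p, ∑ l ∈ Finset.range q, ((k : ℝ)/p + (l : ℝ)/q - 1) ^ 2 =
      (q : ℝ) * (((p : ℝ) - 1) * (2 * (p : ℝ) - 1) / (6 * (p : ℝ)))
      + (p : ℝ) * (((q : ℝ) - 1) * (2 * (q : ℝ) - 1) / (6 * (q : ℝ))) + (p : ℝ) * (q : ℝ)
      + ((p : ℝ) - 1) * ((q : ℝ) - 1) / 2 - (q : ℝ) * ((p : ℝ) - 1) - (p : ℝ) * ((q : ℝ) - 1) := by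
  have hp' : (0 : ℝ) < p := by exact_mod_cast (by omega : 0 < p)
  have hq' : (0 : ℝ) < q := by exact_mod_cast (by omega : 0 < q)
  have e : ∀ k l : ℕ, ((k : ℝ)/p + (l : ℝ)/q - 1) ^ 2 =
      (1 / (p : ℝ) ^ 2) * (k : ℝ) ^ 2 + (1 / (q : ℝ) ^ 2) * (l : ℝ) ^ 2 + 1 + (2 / (p * q) * k) * l
        - (2 / p) * k - (2 / q) * l := by
    intro k l; field_simp; ring
  simp only [e, Finset.sum_add_distrib, Finset.sum_sub_distrib, ← Finset.mul_sum,
    ← Finset.sum_mul, dsf_sum1, dsf_sum2, Finset.sum_const, Finset.card_range, nsmul_eq_mul]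
  field_simp

theorem discrete_sum_formula (p q : ℕ) (hp : 2 ≤ p) (hq : 2 ≤ q)
    (hpq : Nat.Coprime p q) :
    ∑ k ∈ Finset.Icc 1 (p - 1), ∑ l ∈ Finset.Icc 1 (q - 1),
      (1 - 2 * |(k : ℝ)/p + (l : ℝ)/q - 1|) =
      (1/3) * ((p : ℝ) - 1/p) * ((q : ℝ) - 1/q) := by
  have hp' : (0 : ℝ) < p := by exact_mod_cast (by omega : 0 < p)
  have hq' : (0 : ℝ) < q := by exact_mod_cast (by omega : 0 < q)
  have hfull : ∑ k ∈ Finset.range p, ∑ l ∈ Finset.range q, |(k : ℝ)/p + (l : ℝ)/q - 1| =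
      (∑ k ∈ Finset.range p, ∑ l ∈ Finset.range q, ((k : ℝ)/p + (l : ℝ)/q - 1) ^ 2) +
      ((p * q : ℝ) ^ 2 - 1) / (6 * (p * q)) := by
    have h1 := dsf_crt p q hp hq hpq
      (fun j : ℕ => ((j : ℝ) / (p * q)) * (1 - (j : ℝ) / (p * q)))
    have h2 : ∑ j ∈ Finset.range (p * q), ((j : ℝ) / (p * q)) * (1 - (j : ℝ) / (p * q)) =
        ((p * q : ℝ) ^ 2 - 1) / (6 * (p * q)) := by
      have e : ∀ j : ℕ, ((j : ℝ) / (p * q)) * (1 - (j : ℝ) / (p * q)) =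
          (1 / (p * q)) * (j : ℝ) - (1 / (p * q) ^ 2) * (j : ℝ) ^ 2 := by
        intro j; ring
      simp only [e, Finset.sum_sub_distrib, ← Finset.mul_sum, dsf_sum1, dsf_sum2]
      push_cast
      field_simp
      ring
    rw [← h2, ← h1]
    simp only [← Finset.sum_add_distrib]
    exact Finset.sum_congr rfl fun k hk => Finset.sum_congr rfl fun l hl =>
      dsf_point p q k l (Finset.mem_range.1 hk) (Finset.mem_range.1 hl)
  have hr := dsf_row q hq
  have hc := dsf_row p hp
  rw [dsf_split p hp]
  simp only [dsf_split q hq]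
  simp only [Finset.sum_sub_distrib] at hr hc ⊢
  simp only [← Finset.mul_sum, Finset.sum_const, Finset.card_range, nsmul_eq_mul, Nat.cast_zero,
    zero_div, zero_add, add_zero, hfull, dsf_sq p q hp hq] at hr hc ⊢
  have habs : |(0 : ℝ) - 1| = 1 := by norm_num
  rw [habs]
  generalize ∑ l ∈ Finset.range q, |(l : ℝ)/q - 1| = A at *
  generalize ∑ l ∈ Finset.range p, |(l : ℝ)/p - 1| = B at *
  have hA : A = (q + 1) / 2 := by linarith
  have hB : B = (p + 1) / 2 := by linarith
  rw [hA, hB]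
  field_simp
  ring
end

section
/- For coprime integers p, q ≥ 2, the integral I = ∫₀¹ σ(e^{2πix}) dx of the Tristram–Levine signature function of the torus knot T_{p,q} satisfies I = 4(s(p,q) + s(q,p) − s(1,pq)), where s(·,·) is the Dedekind sum. -/
open scoped Classical

lemma saw_of_int (x : ℝ) (n : ℤ) (h : x = n) : saw x = 0 := by
  unfold saw; rw [if_pos ⟨n, h⟩]

lemma saw_of_mem (x : ℝ) (n : ℤ) (h1 : (n:ℝ) < x) (h2 : x < n + 1) : saw x = x - n - 1/2 := by
  have hf : ⌊x⌋ = n := Int.floor_eq_iff.2 ⟨h1.le, h2⟩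
  unfold saw
  rw [if_neg, Int.fract, hf]
  rintro ⟨m, hm⟩
  rw [hm] at h1 h2
  have h3 : n < m := by exact_mod_cast h1
  have h4 : m < n + 1 := by exact_mod_cast h2
  omega

lemma saw_add_nat (x : ℝ) (n : ℕ) : saw (x + n) = saw x := by
  unfold saw
  have : (∃ m : ℤ, x + n = m) ↔ (∃ m : ℤ, x = m) := by
    constructor
    · rintro ⟨m, hm⟩; exact ⟨m - n, by push_cast; linarith⟩
    · rintro ⟨m, hm⟩; exact ⟨m + n, by push_cast; linarith⟩
  simp only [this, Int.fract_add_natCast]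

lemma sum_shift (f : ℕ → ℝ) (q : ℕ) (hf : ∀ n, f (n + q) = f n) (m : ℕ) :
    ∑ l ∈ Finset.range q, f (l + m) = ∑ l ∈ Finset.range q, f l := by
  induction m with
  | zero => simp
  | succ m ih =>
    rw [← ih]
    have h1 := Finset.sum_range_succ (fun l => f (l + m)) q
    have h2 := Finset.sum_range_succ' (fun l => f (l + m)) q
    have h3 := hf m
    simp only [zero_add] at h2
    rw [add_comm q m, h3] at h1
    have h4 : ∑ l ∈ Finset.range q, f (l + (m + 1)) = ∑ l ∈ Finset.range q, f (l + 1 + m) :=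
      Finset.sum_congr rfl (fun l _ => by congr 1; ring)
    rw [h4]
    linarith

lemma sum_id (q : ℕ) : ∑ l ∈ Finset.range q, (l : ℝ) = q * (q - 1) / 2 := by
  induction q with
  | zero => simp
  | succ q ih => rw [Finset.sum_range_succ, ih]; push_cast; ring

lemma saw_mul (q : ℕ) (hq : 2 ≤ q) (x : ℝ) (hx : 0 ≤ x) :
    ∑ l ∈ Finset.range q, saw (x + (l : ℝ) / q) = saw (q * x) := by
  have hq0 : (0:ℝ) < q := by positivity
  obtain ⟨m, r, hr0, hr1, hm⟩ : ∃ (m : ℕ) (r : ℝ), 0 ≤ r ∧ r < 1 ∧ q * x = m + r := by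
    refine ⟨⌊(q:ℝ) * x⌋₊, q * x - ⌊(q:ℝ) * x⌋₊, ?_, ?_, by ring⟩
    · have := Nat.floor_le (show 0 ≤ (q:ℝ) * x by positivity); linarith
    · have := Nat.lt_floor_add_one ((q:ℝ) * x); linarith
  have hx' : x = (m + r) / q := by rw [← hm]; field_simp
  have h1 : ∑ l ∈ Finset.range q, saw (x + (l : ℝ) / q)
      = ∑ l ∈ Finset.range q, saw ((l + r) / q) := by
    have := sum_shift (fun l => saw (((l:ℝ) + r) / q)) q (fun n => by
      rw [← saw_add_nat (((n:ℝ) + r) / q) 1]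
      congr 1; push_cast; field_simp; ring) m
    rw [← this]
    refine Finset.sum_congr rfl (fun l _ => ?_)
    rw [hx']; congr 1; push_cast; ring
  have key : ∀ l ∈ Finset.range q, 0 < l + r → saw ((l + r) / q) = (l + r) / q - 1/2 := by
    intro l hl h
    have hl' : (l:ℝ) + 1 ≤ q := by exact_mod_cast Finset.mem_range.1 hl
    have := saw_of_mem ((l + r) / q) 0 (by push_cast; positivity)
      (by push_cast; rw [zero_add, div_lt_one hq0]; linarith)
    rw [this]; push_cast; ring
  have hs : ∑ l ∈ Finset.range q, (((l:ℝ) + r) / q - 1/2) = r - 1/2 := by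
    rw [Finset.sum_sub_distrib, ← Finset.sum_div, Finset.sum_add_distrib, sum_id]
    simp
    field_simp
    ring
  rw [h1, hm]
  rcases hr0.eq_or_lt with h | h
  · subst h
    rw [saw_of_int _ m (by push_cast; ring)]
    obtain ⟨n, rfl⟩ : ∃ n, q = n + 1 := ⟨q - 1, by omega⟩
    rw [Finset.sum_range_succ'] at hs ⊢
    rw [Finset.sum_congr rfl (fun l hl => key (l + 1) (by simpa using hl) (by positivity)),
      saw_of_int _ 0 (by simp)]
    simp at hs ⊢
    linarith
  · rw [Finset.sum_congr rfl (fun l hl => key l hl (by positivity)), hs,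
      saw_of_mem _ m (by push_cast; linarith) (by push_cast; linarith)]
    push_cast; ring

lemma crt_inj (p q : ℕ) (hpq : Nat.Coprime p q) (k l k' l' : ℕ)
    (hk : k < p) (hl : l < q) (hk' : k' < p) (hl' : l' < q)
    (h : k * q + l * p ≡ k' * q + l' * p [MOD p * q]) : k = k' ∧ l = l' := by
  have h1 : k * q + l * p ≡ k' * q + l' * p [MOD p] := h.of_mul_right q
  have h2 : k * q + l * p ≡ k' * q + l' * p [MOD q] := h.of_mul_left p
  have h3 : k * q ≡ k' * q [MOD p] := by simpa [Nat.ModEq] using h1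
  have h4 : l * p ≡ l' * p [MOD q] := by simpa [Nat.ModEq] using h2
  exact ⟨(Nat.ModEq.cancel_right_of_coprime hpq h3).eq_of_lt_of_lt hk hk',
    (Nat.ModEq.cancel_right_of_coprime hpq.symm h4).eq_of_lt_of_lt hl hl'⟩

lemma sum_sq (p q : ℕ) (hp : 2 ≤ p) (hq : 2 ≤ q) (hpq : Nat.Coprime p q) :
    ∑ kl ∈ Finset.range p ×ˢ Finset.range q,
      saw ((kl.1 : ℝ) / p + (kl.2 : ℝ) / q) * saw ((kl.1 : ℝ) / p + (kl.2 : ℝ) / q)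
      = dedekindSum 1 (p * q) := by
  have hp0 : (0:ℝ) < p := by positivity
  have hq0 : (0:ℝ) < q := by positivity
  have hpos : 0 < p * q := by positivity
  unfold dedekindSum
  have hmaps : Set.MapsTo (fun kl : ℕ × ℕ => (kl.1 * q + kl.2 * p) % (p * q))
      (Finset.range p ×ˢ Finset.range q : Finset (ℕ × ℕ)) (Finset.range (p * q)) := by
    intro kl _
    simpa using Nat.mod_lt _ hpos
  have hinj : Set.InjOn (fun kl : ℕ × ℕ => (kl.1 * q + kl.2 * p) % (p * q))
      (Finset.range p ×ˢ Finset.range q : Finset (ℕ × ℕ)) := by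
    rintro ⟨k, l⟩ h ⟨k', l'⟩ h' he
    simp only [Finset.coe_product, Finset.coe_range, Set.mem_prod, Set.mem_Iio] at h h'
    have := crt_inj p q hpq k l k' l' h.1 h.2 h'.1 h'.2 he
    rw [this.1, this.2]
  refine Finset.sum_nbij (fun kl : ℕ × ℕ => (kl.1 * q + kl.2 * p) % (p * q))
    hmaps hinj
    (Finset.surjOn_of_injOn_of_card_le _ hmaps hinj (by simp)) ?_
  rintro ⟨k, l⟩ _
  have e : saw ((k : ℝ) / p + (l : ℝ) / q)
      = saw ((((k * q + l * p) % (p * q) : ℕ) : ℝ) / ((p * q : ℕ) : ℝ)) := by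
    rw [← saw_add_nat ((((k * q + l * p) % (p * q) : ℕ) : ℝ) / ((p * q : ℕ) : ℝ))
      ((k * q + l * p) / (p * q))]
    congr 1
    have h := Nat.mod_add_div (k * q + l * p) (p * q)
    have h' : (((k * q + l * p) % (p * q) : ℕ) : ℝ)
      + (p * q) * (((k * q + l * p) / (p * q) : ℕ) : ℝ) = k * q + l * p := by exact_mod_cast h
    rw [Nat.cast_mul p q]
    field_simp
    linarith
  simp only [Nat.cast_one, one_mul]
  rw [← e]

lemma sig_integral_single (y : ℝ) (h0 : 0 < y) (h2 : y < 2) :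
    IntervalIntegrable (fun x => if y ∈ Set.Ioo x (x + 1) then (-1:ℝ) else 1)
      MeasureTheory.volume 0 1 ∧
    ∫ x in (0:ℝ)..1, (if y ∈ Set.Ioo x (x + 1) then (-1:ℝ) else 1) = 2 * |y - 1| - 1 := by
  have e : (fun x => if y ∈ Set.Ioo x (x + 1) then (-1:ℝ) else 1)
      = fun x => 1 - 2 * (Set.Ioo (y - 1) y).indicator (fun _ => (1:ℝ)) x := by
    funext x
    have : y ∈ Set.Ioo x (x + 1) ↔ x ∈ Set.Ioo (y - 1) y := by
      simp only [Set.mem_Ioo]; constructor <;> rintro ⟨a, b⟩ <;> constructor <;> linarith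
    by_cases h : x ∈ Set.Ioo (y - 1) y
    · rw [if_pos (this.2 h), Set.indicator_of_mem h]; norm_num
    · rw [if_neg (fun h' => h (this.1 h')), Set.indicator_of_notMem h]; norm_num
  have hi : IntervalIntegrable (fun x => (Set.Ioo (y - 1) y).indicator (fun _ => (1:ℝ)) x)
      MeasureTheory.volume 0 1 := by
    rw [intervalIntegrable_iff_integrableOn_Ioc_of_le zero_le_one]
    exact (MeasureTheory.integrable_const (1:ℝ)).indicator measurableSet_Ioo
  rw [e]
  refine ⟨intervalIntegrable_const.sub (hi.const_mul 2), ?_⟩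
  rw [intervalIntegral.integral_sub intervalIntegrable_const (hi.const_mul 2),
    intervalIntegral.integral_const_mul]
  have hv : ∫ x in (0:ℝ)..1, (Set.Ioo (y - 1) y).indicator (fun _ => (1:ℝ)) x = 1 - |y - 1| := by
    rw [intervalIntegral.integral_of_le zero_le_one,
      MeasureTheory.setIntegral_congr_set MeasureTheory.Ioo_ae_eq_Ioc.symm,
      MeasureTheory.setIntegral_indicator measurableSet_Ioo, Set.Ioo_inter_Ioo]
    simp only [MeasureTheory.setIntegral_const, smul_eq_mul, mul_one, Real.volume_real_Ioo]
    rcases le_total y 1 with h | h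
    · rw [abs_of_nonpos (by linarith)]
      rw [sup_eq_left.2 (by linarith : y - 1 ≤ 0), inf_eq_right.2 h, max_eq_left (by linarith)]
      ring
    · rw [abs_of_nonneg (by linarith)]
      rw [sup_eq_right.2 (by linarith : 0 ≤ y - 1), inf_eq_left.2 h, max_eq_left (by linarith)]
  rw [hv]; simp; ring

lemma sigHat_eq (p q : ℕ) (x : ℝ) : (sigHat p q x : ℝ)
    = ∑ y ∈ sigmaSet p q, (if y ∈ Set.Ioo x (x + 1) then (-1:ℝ) else 1) := by
  unfold sigHat
  rw [Finset.sum_ite]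
  simp
  ring

lemma pointwise (a b : ℝ) (ha : 0 < a) (ha1 : a < 1) (hb : 0 < b) (hb1 : b < 1)
    (hab : a + b ≠ 1) :
    2 * |a + b - 1| - 1 = 4 * (saw (a + b) * (saw a + saw b) - saw (a + b) * saw (a + b)) := by
  rw [saw_of_mem a 0 (by simpa) (by simpa), saw_of_mem b 0 (by simpa) (by simpa)]
  rcases lt_or_gt_of_ne hab with h | h
  · rw [saw_of_mem (a + b) 0 (by push_cast; linarith) (by push_cast; linarith),
      abs_of_neg (by linarith)]
    push_cast; ring
  · rw [saw_of_mem (a + b) 1 (by push_cast; linarith) (by push_cast; linarith),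
      abs_of_pos (by linarith)]
    push_cast; ring

lemma sum_int (p q : ℕ) (hp : 2 ≤ p) (hq : 2 ≤ q) :
    ∑ kl ∈ Finset.range p ×ˢ Finset.range q,
      saw ((kl.1 : ℝ) / p + (kl.2 : ℝ) / q) * saw ((kl.1 : ℝ) / p) = dedekindSum q p := by
  rw [Finset.sum_product]
  unfold dedekindSum
  refine Finset.sum_congr rfl (fun k _ => ?_)
  simp only
  rw [← Finset.sum_mul, saw_mul q hq _ (by positivity), mul_comm, mul_div_assoc]

lemma sum_int2 (p q : ℕ) (hp : 2 ≤ p) (hq : 2 ≤ q) :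
    ∑ kl ∈ Finset.range p ×ˢ Finset.range q,
      saw ((kl.1 : ℝ) / p + (kl.2 : ℝ) / q) * saw ((kl.2 : ℝ) / q) = dedekindSum p q := by
  rw [Finset.sum_product_right, ← sum_int q p hq hp, Finset.sum_product]
  simp only [add_comm]

theorem integral_signature_eq_dedekind (p q : ℕ) (hp : 2 ≤ p) (hq : 2 ≤ q)
    (hpq : Nat.Coprime p q) :
    ∫ x in (0:ℝ)..1, (sigHat p q x : ℝ) =
      4 * (dedekindSum p q + dedekindSum q p - dedekindSum 1 (p * q)) := by
  have hp0 : (0:ℝ) < p := by positivity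
  have hq0 : (0:ℝ) < q := by positivity
  have bnd : ∀ (p k : ℕ), 2 ≤ p → k ∈ Finset.Icc 1 (p - 1) →
      k < p ∧ 0 < (k:ℝ) / p ∧ (k:ℝ) / p < 1 := by
    intro p k hp hk
    rw [Finset.mem_Icc] at hk
    have h1 : k < p := by omega
    have h0 : 0 < k := by omega
    refine ⟨h1, by positivity, ?_⟩
    rw [div_lt_one (by positivity)]
    exact_mod_cast h1
  have hinj : Set.InjOn (fun kl : ℕ × ℕ => (kl.1 : ℝ) / p + (kl.2 : ℝ) / q)
      ((Finset.Icc 1 (p - 1)) ×ˢ (Finset.Icc 1 (q - 1)) : Finset (ℕ × ℕ)) := by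
    rintro ⟨k, l⟩ h ⟨k', l'⟩ h' he
    rw [Finset.mem_coe, Finset.mem_product] at h h'
    have he' : k * q + l * p = k' * q + l' * p := by
      simp only at he
      field_simp at he
      have : (k:ℝ) * q + l * p = k' * q + l' * p := by linarith
      exact_mod_cast this
    have := crt_inj p q hpq k l k' l' (bnd p k hp h.1).1 (bnd q l hq h.2).1
      (bnd p k' hp h'.1).1 (bnd q l' hq h'.2).1 (by rw [he'])
    rw [this.1, this.2]
  have hy : ∀ y ∈ sigmaSet p q, 0 < y ∧ y < 2 := by
    intro y hy
    unfold sigmaSet at hy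
    rw [Finset.mem_image] at hy
    obtain ⟨⟨k, l⟩, h, rfl⟩ := hy
    rw [Finset.mem_product] at h
    have h1 := bnd p k hp h.1
    have h2 := bnd q l hq h.2
    simp only
    constructor <;> linarith [h1.2.1, h1.2.2, h2.2.1, h2.2.2]
  simp only [sigHat_eq]
  rw [intervalIntegral.integral_finsetSum (fun y h => (sig_integral_single y (hy y h).1 (hy y h).2).1),
    Finset.sum_congr rfl (fun y h => (sig_integral_single y (hy y h).1 (hy y h).2).2)]
  rw [← sum_sq p q hp hq hpq, ← sum_int p q hp hq, ← sum_int2 p q hp hq,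
    ← Finset.sum_add_distrib, ← Finset.sum_sub_distrib, Finset.mul_sum]
  unfold sigmaSet
  rw [Finset.sum_image hinj]
  have hsub : (Finset.Icc 1 (p - 1)) ×ˢ (Finset.Icc 1 (q - 1)) ⊆
      Finset.range p ×ˢ Finset.range q := by
    rintro ⟨k, l⟩ h
    rw [Finset.mem_product] at h ⊢
    exact ⟨Finset.mem_range.2 (bnd p k hp h.1).1, Finset.mem_range.2 (bnd q l hq h.2).1⟩
  rw [← Finset.sum_subset hsub]
  · refine Finset.sum_congr rfl ?_
    rintro ⟨k, l⟩ h
    rw [Finset.mem_product] at h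
    have h1 := bnd p k hp h.1
    have h2 := bnd q l hq h.2
    have hne : (k:ℝ) / p + (l:ℝ) / q ≠ 1 := by
      intro he
      have he' : k * q + l * p = p * q := by
        field_simp at he
        have : (k:ℝ) * q + l * p = p * q := by linarith
        exact_mod_cast this
      have := crt_inj p q hpq k l 0 0 h1.1 h2.1 (by omega) (by omega)
        (by rw [he']; simp [Nat.ModEq])
      have h3 := (Finset.mem_Icc.1 h.1).1
      simp only at h3
      omega
    simp only
    rw [pointwise _ _ h1.2.1 h1.2.2 h2.2.1 h2.2.2 hne]
    ring
  · rintro ⟨k, l⟩ h hn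
    have hz : k = 0 ∨ l = 0 := by
      simp only [Finset.mem_product, Finset.mem_range, Finset.mem_Icc] at h hn
      omega
    have s0 : saw 0 = 0 := saw_of_int 0 0 (by simp)
    rcases hz with rfl | rfl
    · simp [s0]
    · simp [s0]
end

section
/- (Dedekind reciprocity law) For coprime integers p, q ≥ 1, s(p,q) + s(q,p) = (1/12)(p/q + q/p + 1/(pq)) − 1/4. -/
open scoped Classical

lemma aux_perm (p q : ℕ) (hq : 1 ≤ q) (hpq : Nat.Coprime p q) (h : ℕ → ℝ) :
    ∑ j ∈ Finset.range q, h (p * j % q) = ∑ j ∈ Finset.range q, h j := by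
  have hinj : Set.InjOn (fun j => p * j % q) (Finset.range q : Set ℕ) := by
    intro a ha b hb hab
    have ha' : a < q := by simpa using ha
    have hb' : b < q := by simpa using hb
    have h1 : p * a ≡ p * b [MOD q] := hab
    have h2 : a ≡ b [MOD q] := Nat.ModEq.cancel_left_of_coprime (by simpa using hpq.symm) h1
    exact Nat.ModEq.eq_of_lt_of_lt h2 ha' hb'
  have himg : (Finset.range q).image (fun j => p * j % q) = Finset.range q := by
    apply Finset.eq_of_subset_of_card_le
    · intro x hx
      obtain ⟨j, _, rfl⟩ := Finset.mem_image.1 hx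
      exact Finset.mem_range.2 (Nat.mod_lt _ hq)
    · rw [Finset.card_image_of_injOn hinj]
  conv_rhs => rw [← himg]
  rw [Finset.sum_image hinj]

lemma aux_s1 (q : ℕ) : ∑ j ∈ Finset.range q, (j : ℝ) = q * (q - 1) / 2 := by
  induction q with
  | zero => simp
  | succ n ih => rw [Finset.sum_range_succ, ih]; push_cast; ring

lemma aux_s2 (q : ℕ) :
    ∑ j ∈ Finset.range q, (j : ℝ) ^ 2 = q * (q - 1) * (2 * q - 1) / 6 := by
  induction q with
  | zero => simp
  | succ n ih => rw [Finset.sum_range_succ, ih]; push_cast; ring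

lemma aux_tail (f p : ℕ) (h : f + 1 ≤ p) :
    ∑ k ∈ Finset.range p, (if f < k then (k : ℝ) else 0) =
      (p * (p - 1) - f * (f + 1)) / 2 := by
  induction p, h using Nat.le_induction with
  | base =>
    rw [Finset.sum_eq_zero]
    · push_cast; ring
    · intro k hk
      rw [if_neg]
      have := Finset.mem_range.1 hk
      omega
  | succ n hn ih =>
    rw [Finset.sum_range_succ, ih, if_pos (by omega)]; push_cast; ring

lemma aux_count (p q k : ℕ) (hp : 1 ≤ p) (hq : 1 ≤ q) (hk : k < p) :
    ∑ j ∈ Finset.range q, (if p * j ≤ q * k then (k : ℝ) else 0) =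
      k * ((q * k / p : ℕ) + 1) := by
  have hf : (Finset.range q).filter (fun j => p * j ≤ q * k) = Finset.range (q * k / p + 1) := by
    ext j
    simp only [Finset.mem_filter, Finset.mem_range, Nat.lt_succ_iff, Nat.le_div_iff_mul_le hp]
    rw [mul_comm j p]
    constructor
    · exact fun h => h.2
    · intro h
      refine ⟨?_, h⟩
      by_contra hc
      push Not at hc
      have h1 : p * q ≤ p * j := Nat.mul_le_mul_left _ hc
      have h2 : q * k < q * p := Nat.mul_lt_mul_of_pos_left hk hq
      nlinarith
  rw [← Finset.sum_filter, hf]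
  simp
  ring

lemma aux_iff (p q j k : ℕ) (hp : 1 ≤ p) (hq : 1 ≤ q) (hpq : Nat.Coprime p q) (hk : k < p) :
    (if p * j ≤ q * k then (k : ℝ) else 0) = if p * j / q < k then (k : ℝ) else 0 := by
  rcases Nat.eq_zero_or_pos k with rfl | hk0
  · simp
  · have : p * j ≤ q * k ↔ p * j / q < k := by
      rw [Nat.div_lt_iff_lt_mul hq, mul_comm k q]
      constructor
      · intro h
        refine lt_of_le_of_ne h fun he => ?_
        have h1 : p ∣ q * k := ⟨j, he.symm⟩
        have h2 := Nat.le_of_dvd hk0 (hpq.dvd_of_dvd_mul_left h1)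
        omega
      · exact le_of_lt
    simp only [this]

lemma aux_double (p q : ℕ) (hp : 1 ≤ p) (hq : 1 ≤ q) (hpq : Nat.Coprime p q) :
    ∑ k ∈ Finset.range p, (k : ℝ) * ((q * k / p : ℕ) + 1) =
      ∑ j ∈ Finset.range q,
        ((p : ℝ) * (p - 1) - (p * j / q : ℕ) * ((p * j / q : ℕ) + 1)) / 2 := by
  calc _ = ∑ k ∈ Finset.range p, ∑ j ∈ Finset.range q,
        (if p * j ≤ q * k then (k : ℝ) else 0) :=
        Finset.sum_congr rfl fun k hk =>
          (aux_count p q k hp hq (Finset.mem_range.1 hk)).symm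
    _ = ∑ j ∈ Finset.range q, ∑ k ∈ Finset.range p,
        (if p * j ≤ q * k then (k : ℝ) else 0) := Finset.sum_comm
    _ = _ := Finset.sum_congr rfl fun j hj => by
        rw [Finset.sum_congr rfl fun k hk =>
          aux_iff p q j k hp hq hpq (Finset.mem_range.1 hk)]
        apply aux_tail
        have hj := Finset.mem_range.1 hj
        rw [Nat.succ_le_iff, Nat.div_lt_iff_lt_mul hq]
        exact Nat.mul_lt_mul_of_pos_left hj hp

lemma aux_mod (p q j : ℕ) : ((p * j % q : ℕ) : ℝ) = p * j - q * (p * j / q : ℕ) := by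
  have := Nat.mod_add_div (p * j) q
  have h : ((p * j % q : ℕ) : ℝ) + q * (p * j / q : ℕ) = p * j := by exact_mod_cast this
  linarith

lemma aux_saw (n q : ℕ) (hq : 1 ≤ q) (h : ¬ q ∣ n) :
    saw ((n : ℝ) / q) = n / q - (n / q : ℕ) - 1 / 2 := by
  have hq0 : (q : ℝ) ≠ 0 := by positivity
  unfold saw
  rw [if_neg]
  · rw [Int.fract, ← natCast_floor_eq_intCast_floor (by positivity), Nat.floor_div_eq_div]
  · rintro ⟨m, hm⟩
    apply h
    rw [div_eq_iff hq0] at hm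
    have h1 : (n : ℤ) = m * q := by exact_mod_cast hm
    exact Int.natCast_dvd_natCast.1 ⟨m, by rw [h1]; ring⟩

lemma aux_ded (p q : ℕ) (hq : 1 ≤ q) (hpq : Nat.Coprime p q) :
    dedekindSum p q = ∑ j ∈ Finset.range q,
      ((j : ℝ) / q - 1 / 2) * ((p : ℝ) * j / q - (p * j / q : ℕ) - 1 / 2) - 1 / 4 := by
  unfold dedekindSum
  obtain ⟨m, rfl⟩ : ∃ m, q = m + 1 := ⟨q - 1, by omega⟩
  rw [Finset.sum_range_succ', Finset.sum_range_succ']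
  have h0 : saw 0 = 0 := if_pos ⟨0, by simp⟩
  have : ∀ j ∈ Finset.range m, saw (((j + 1 : ℕ) : ℝ) / (m + 1 : ℕ)) *
      saw ((p : ℝ) * (j + 1 : ℕ) / (m + 1 : ℕ)) =
      (((j + 1 : ℕ) : ℝ) / (m + 1 : ℕ) - 1 / 2) *
      ((p : ℝ) * (j + 1 : ℕ) / (m + 1 : ℕ) - (p * (j + 1) / (m + 1) : ℕ) - 1 / 2) := by
    intro j hj
    have hj := Finset.mem_range.1 hj
    have hd : ¬ (m + 1) ∣ (j + 1) := fun h => by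
      have := Nat.le_of_dvd (by omega) h
      omega
    have hd2 : ¬ (m + 1) ∣ p * (j + 1) := fun h => hd (hpq.symm.dvd_of_dvd_mul_left h)
    rw [aux_saw _ _ hq hd, ← Nat.cast_mul, aux_saw _ _ hq hd2,
      Nat.div_eq_of_lt (by omega : j + 1 < m + 1)]
    simp
  rw [Finset.sum_congr rfl this]
  simp [h0]
  norm_num

lemma aux_expand (p q : ℕ) (hq : 1 ≤ q) (hpq : Nat.Coprime p q) :
    dedekindSum p q = (p : ℝ) / q ^ 2 * (q * (q - 1) * (2 * q - 1) / 6)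
      - (∑ j ∈ Finset.range q, (j : ℝ) * (p * j / q : ℕ)) / q
      - (1 / 2 / q + p / 2 / q) * (q * (q - 1) / 2)
      + (∑ j ∈ Finset.range q, ((p * j / q : ℕ) : ℝ)) / 2 + q / 4 - 1 / 4 := by
  rw [aux_ded p q hq hpq, ← aux_s1, ← aux_s2]
  have hc : (q : ℝ) / 4 = ∑ j ∈ Finset.range q, (1 / 4 : ℝ) := by simp; ring
  rw [hc, Finset.mul_sum, Finset.mul_sum, Finset.sum_div, Finset.sum_div,
    ← Finset.sum_sub_distrib, ← Finset.sum_sub_distrib, ← Finset.sum_add_distrib,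
    ← Finset.sum_add_distrib]
  congr 1
  apply Finset.sum_congr rfl
  intro j _
  have hq0 : (q : ℝ) ≠ 0 := by positivity
  field_simp
  ring

lemma aux_F1 (p q : ℕ) (hq : 1 ≤ q) (hpq : Nat.Coprime p q) :
    ∑ j ∈ Finset.range q, ((p * j / q : ℕ) : ℝ) = ((p : ℝ) - 1) * (q - 1) / 2 := by
  have h := aux_perm p q hq hpq (fun x => (x : ℝ))
  simp only [aux_mod] at h
  rw [Finset.sum_sub_distrib, ← Finset.mul_sum, ← Finset.mul_sum, aux_s1] at h
  have hq0 : (q : ℝ) ≠ 0 := by positivity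
  apply mul_left_cancel₀ hq0
  linarith

lemma aux_F2 (p q : ℕ) (hq : 1 ≤ q) (hpq : Nat.Coprime p q) :
    (q : ℝ) ^ 2 * ∑ j ∈ Finset.range q, ((p * j / q : ℕ) : ℝ) ^ 2 =
      2 * p * q * (∑ j ∈ Finset.range q, (j : ℝ) * (p * j / q : ℕ))
      - ((p : ℝ) ^ 2 - 1) * (q * (q - 1) * (2 * q - 1) / 6) := by
  have h := aux_perm p q hq hpq (fun x => (x : ℝ) ^ 2)
  simp only [aux_mod] at h
  have h2 : ∑ j ∈ Finset.range q, ((p : ℝ) * j - q * (p * j / q : ℕ)) ^ 2 =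
      (p : ℝ) ^ 2 * ∑ j ∈ Finset.range q, (j : ℝ) ^ 2
      - 2 * p * q * (∑ j ∈ Finset.range q, (j : ℝ) * (p * j / q : ℕ))
      + (q : ℝ) ^ 2 * ∑ j ∈ Finset.range q, ((p * j / q : ℕ) : ℝ) ^ 2 := by
    rw [Finset.mul_sum, Finset.mul_sum, Finset.mul_sum, ← Finset.sum_sub_distrib,
      ← Finset.sum_add_distrib]
    exact Finset.sum_congr rfl fun j _ => by ring
  rw [h2, aux_s2] at h
  linarith

theorem dedekind_reciprocity (p q : ℕ) (hp : 1 ≤ p) (hq : 1 ≤ q)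
    (hpq : Nat.Coprime p q) :
    dedekindSum p q + dedekindSum q p =
      (1/12) * ((p : ℝ)/q + (q : ℝ)/p + 1/(p * q)) - 1/4 := by
  have hq0 : (q : ℝ) ≠ 0 := by positivity
  have hp0 : (p : ℝ) ≠ 0 := by positivity
  have hd := aux_double p q hp hq hpq
  have hF2 := aux_F2 p q hq hpq
  have hF1 := aux_F1 p q hq hpq
  have hd1 : ∑ k ∈ Finset.range p, (k : ℝ) * ((q * k / p : ℕ) + 1) =
      ∑ k ∈ Finset.range p, (k : ℝ) * (q * k / p : ℕ) + p * (p - 1) / 2 := by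
    rw [← aux_s1, ← Finset.sum_add_distrib]
    exact Finset.sum_congr rfl fun j _ => by ring
  have hd2 : ∑ j ∈ Finset.range q,
        ((p : ℝ) * (p - 1) - (p * j / q : ℕ) * ((p * j / q : ℕ) + 1)) / 2 =
      q * (p * (p - 1)) / 2 - (∑ j ∈ Finset.range q, ((p * j / q : ℕ) : ℝ) ^ 2) / 2
      - (∑ j ∈ Finset.range q, ((p * j / q : ℕ) : ℝ)) / 2 := by
    have hc : (q : ℝ) * (p * (p - 1)) / 2 =
      ∑ j ∈ Finset.range q, ((p : ℝ) * (p - 1) / 2) := by simp; ring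
    rw [hc, Finset.sum_div, Finset.sum_div, ← Finset.sum_sub_distrib,
      ← Finset.sum_sub_distrib]
    exact Finset.sum_congr rfl fun j _ => by ring
  rw [hd1, hd2, hF1] at hd
  rw [aux_expand p q hq hpq, aux_expand q p hp hpq.symm, hF1, aux_F1 q p hp hpq.symm]
  generalize ∑ j ∈ Finset.range q, (j : ℝ) * (p * j / q : ℕ) = A at *
  generalize ∑ k ∈ Finset.range p, (k : ℝ) * (q * k / p : ℕ) = B at *
  generalize ∑ j ∈ Finset.range q, ((p * j / q : ℕ) : ℝ) ^ 2 = F at *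
  have hB : B = q * (p * (p - 1)) / 2 - F / 2 - ((p : ℝ) - 1) * (q - 1) / 2 / 2
      - p * (p - 1) / 2 := by linarith
  have hA : A = ((q : ℝ) ^ 2 * F + ((p : ℝ) ^ 2 - 1) * (q * (q - 1) * (2 * q - 1) / 6))
      / (2 * p * q) := by
    rw [eq_div_iff (by positivity)]
    linarith
  rw [hA, hB]
  field_simp
  ring
end
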